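/- Let φ be a nonnegative function in L¹_loc(0,∞). Then the operator S_φ, defined by S_φ f(x) = ∫₀^∞ f(tx) φ(t) dt, is bounded on BMO(ℝ) if and only if ∫₀^∞ φ(t) dt < ∞. Moreover, in that case, the operator norm of S_φ on BMO(ℝ) equals ∫₀^∞ φ(t) dt. -/

import Mathlib

open MeasureTheory Complex Filter Set Topology ENNReal NNReal

/-- The BMO seminorm on `ℝ`: the supremum over bounded intervals `(a,b)` of the mean
oscillation of `f` over `(a,b)`. -/
noncomputable def bmoNorm (f : ℝ → ℝ) : ℝ≥0∞ :=
  ⨆ (a : ℝ) (b : ℝ) (_ : a < b),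
    ENNReal.ofReal ((b - a)⁻¹ *
      ∫ x in Set.Ioo a b, |f x - (b - a)⁻¹ * ∫ y in Set.Ioo a b, f y|)

/-- Membership in `BMO(ℝ)`: locally integrable functions with finite BMO seminorm. -/
def MemBMO (f : ℝ → ℝ) : Prop :=
  LocallyIntegrable f volume ∧ bmoNorm f < ⊤

/-- The operator `S_φ f (x) = ∫₀^∞ f(tx) φ(t) dt` on real-valued functions. -/
noncomputable def sOpRR (φ : ℝ → ℝ) (f : ℝ → ℝ) (x : ℝ) : ℝ :=
  ∫ t in Set.Ioi (0 : ℝ), φ t * f (t * x)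


lemma bmo_osc_le {f : ℝ → ℝ} (hf : bmoNorm f < ⊤) {a b : ℝ} (hab : a < b) :
    (b - a)⁻¹ * ∫ x in Set.Ioo a b, |f x - (b - a)⁻¹ * ∫ y in Set.Ioo a b, f y|
      ≤ (bmoNorm f).toReal := by
  rw [← ENNReal.ofReal_le_iff_le_toReal hf.ne]
  unfold bmoNorm
  exact le_iSup_of_le a (le_iSup_of_le b (le_iSup_of_le hab le_rfl))

lemma bmo_Ioo_eq (g : ℝ → ℝ) {a b : ℝ} (hab : a < b) :
    ∫ x in Set.Ioo a b, g x = ∫ x in a..b, g x := by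
  rw [intervalIntegral.integral_of_le hab.le, integral_Ioc_eq_integral_Ioo]

lemma bmo_dilate {f : ℝ → ℝ} (hf : MemBMO f) {a b t : ℝ} (hab : a < b) (ht : 0 < t) :
    ∫ x in Set.Ioo a b, |f (t * x) - (b - a)⁻¹ * ∫ y in Set.Ioo a b, f (t * y)|
      ≤ (bmoNorm f).toReal * (b - a) := by
  have htab : t * a < t * b := by gcongr
  have h := bmo_osc_le hf.2 htab
  have hba : 0 < b - a := sub_pos.2 hab
  rw [bmo_Ioo_eq _ hab, bmo_Ioo_eq (fun y => f (t * y)) hab]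
  rw [bmo_Ioo_eq _ htab, bmo_Ioo_eq _ htab] at h
  rw [intervalIntegral.integral_comp_mul_left f ht.ne']
  rw [intervalIntegral.integral_comp_mul_left
    (fun u => |f u - (b - a)⁻¹ * t⁻¹ • ∫ y in t * a..t * b, f y|) ht.ne']
  have e : (t * b - t * a)⁻¹ = (b - a)⁻¹ * t⁻¹ := by rw [← mul_sub, mul_inv, mul_comm]
  rw [e] at h
  simp only [smul_eq_mul, ← mul_assoc]
  rw [← div_le_iff₀ hba]
  refine le_trans (le_of_eq ?_) h
  ring

lemma bmo_dilate_int {f : ℝ → ℝ} (hf : LocallyIntegrable f volume) {a b t : ℝ} (hab : a < b)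
    (ht : 0 < t) : IntegrableOn (fun x => f (t * x)) (Set.Ioo a b) := by
  have h : IntervalIntegrable f volume (t * a) (t * b) :=
    ((hf.integrableOn_isCompact isCompact_uIcc).mono_set Set.Subset.rfl).intervalIntegrable
  have h2 := h.comp_mul_left (c := t)
  rw [mul_div_cancel_left₀ _ ht.ne', mul_div_cancel_left₀ _ ht.ne'] at h2
  exact ((intervalIntegrable_iff_integrableOn_Ioo_of_le hab.le).1 h2)

lemma bmo_qmp (ν : Measure ℝ) [SFinite ν] (hν : ν ≪ volume) :
    Measure.QuasiMeasurePreserving (fun p : ℝ × ℝ => p.1 * p.2)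
      ((volume.restrict (Set.Ioi 0)).prod ν) volume := by
  refine ⟨by fun_prop, Measure.AbsolutelyContinuous.mk fun s hs h0 => ?_⟩
  have hm : Measurable (fun p : ℝ × ℝ => p.1 * p.2) := by fun_prop
  rw [Measure.map_apply hm hs, Measure.measure_prod_null (hm hs)]
  filter_upwards [ae_restrict_mem measurableSet_Ioi] with t ht
  have ht : (0:ℝ) < t := ht
  apply hν
  have : (Prod.mk t ⁻¹' ((fun p : ℝ × ℝ => p.1 * p.2) ⁻¹' s)) = (fun x => t * x) ⁻¹' s := rfl
  rw [this, Real.volume_preimage_mul_left ht.ne', h0, mul_zero]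

lemma bmo_key {φ f : ℝ → ℝ} (hφ : ∀ t, 0 ≤ φ t) (hi : IntegrableOn φ (Set.Ioi 0))
    (hf : MemBMO f) {a b : ℝ} (hab : a < b) :
    IntegrableOn (sOpRR φ f) (Set.Ioo a b) ∧
    (b - a)⁻¹ * ∫ x in Set.Ioo a b,
      |sOpRR φ f x - (b - a)⁻¹ * ∫ y in Set.Ioo a b, sOpRR φ f y|
      ≤ (∫ t in Set.Ioi (0 : ℝ), φ t) * (bmoNorm f).toReal := by
  have hba : 0 < b - a := sub_pos.2 hab
  set K := (bmoNorm f).toReal with hK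
  have hK0 : 0 ≤ K := ENNReal.toReal_nonneg
  set μ := (volume : Measure ℝ).restrict (Set.Ioi 0) with hμ
  set ν := (volume : Measure ℝ).restrict (Set.Ioo a b) with hν
  have hi' : Integrable φ μ := hi
  have hmem : ∀ᵐ t ∂μ, 0 < t := ae_restrict_mem measurableSet_Ioi
  have hF : AEStronglyMeasurable (fun p : ℝ × ℝ => f (p.1 * p.2)) (μ.prod ν) :=
    hf.1.aestronglyMeasurable.comp_quasiMeasurePreserving
      (bmo_qmp ν Measure.absolutelyContinuous_restrict)
  set m : ℝ → ℝ := fun t => (b - a)⁻¹ * ∫ y, f (t * y) ∂ν with hm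
  have hmm : AEStronglyMeasurable m μ := (hF.integral_prod_right').const_mul _
  set H : ℝ → ℝ → ℝ := fun t x => φ t * (f (t * x) - m t) with hH
  have hHm : AEStronglyMeasurable (Function.uncurry H) (μ.prod ν) :=
    (hi'.aestronglyMeasurable.comp_fst).mul (hF.sub hmm.comp_fst)
  have hbound : ∀ᵐ t ∂μ, ∫ x, ‖H t x‖ ∂ν ≤ φ t * (K * (b - a)) := by
    filter_upwards [hmem] with t ht
    simp only [hH, norm_mul, Real.norm_eq_abs, abs_of_nonneg (hφ t)]
    rw [integral_const_mul]
    exact mul_le_mul_of_nonneg_left (bmo_dilate hf hab ht) (hφ t)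
  have hHi : Integrable (Function.uncurry H) (μ.prod ν) := by
    rw [integrable_prod_iff hHm]
    constructor
    · filter_upwards [hmem] with t ht
      have hd : Integrable (fun x => f (t * x)) ν := bmo_dilate_int hf.1 hab ht
      exact (hd.sub (integrable_const (m t))).const_mul (φ t)
    · refine (hi'.mul_const (K * (b - a))).mono' hHm.norm.integral_prod_right' ?_
      filter_upwards [hbound] with t ht
      rw [Real.norm_of_nonneg (integral_nonneg fun _ => norm_nonneg _)]
      exact ht
  have hHx : ∀ᵐ x ∂ν, Integrable (fun t => H t x) μ := hHi.prod_left_ae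
  have hG : Integrable (fun x => ∫ t, H t x ∂μ) ν := hHi.integral_prod_right
  have hνr : ν.real univ = b - a := by
    simp [hν, Measure.real, ENNReal.toReal_ofReal hba.le]
  by_cases hc : Integrable (fun t => φ t * m t) μ
  · set c := ∫ t, φ t * m t ∂μ with hcdef
    have hS : ∀ᵐ x ∂ν, sOpRR φ f x = ∫ t, H t x ∂μ + c := by
      filter_upwards [hHx] with x hx
      rw [hcdef, ← integral_add hx hc]
      unfold sOpRR
      refine integral_congr_ae (ae_of_all _ fun t => ?_)
      simp only [hH]; ring
    have hSi : Integrable (sOpRR φ f) ν :=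
      (hG.add (integrable_const c)).congr (hS.mono fun x hx => hx.symm)
    refine ⟨hSi, ?_⟩
    have hzero : ∫ x, ∫ t, H t x ∂μ ∂ν = 0 := by
      rw [← integral_integral_swap hHi]
      refine integral_eq_zero_of_ae ?_
      filter_upwards [hmem] with t ht
      simp only [hH, Pi.zero_apply]
      rw [integral_const_mul, integral_sub (bmo_dilate_int hf.1 hab ht) (integrable_const _),
        integral_const, hνr, smul_eq_mul]
      simp only [hm]
      rw [mul_inv_cancel_left₀ hba.ne', sub_self, mul_zero]
    have hmean : (b - a)⁻¹ * ∫ y, sOpRR φ f y ∂ν = c := by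
      rw [integral_congr_ae hS, integral_add hG (integrable_const _), hzero, integral_const, hνr,
        smul_eq_mul, zero_add, inv_mul_cancel_left₀ hba.ne']
    rw [hmean]
    have h1 : ∫ x, |sOpRR φ f x - c| ∂ν ≤ ∫ x, ∫ t, ‖H t x‖ ∂μ ∂ν := by
      refine integral_mono_ae ((hSi.sub (integrable_const c)).abs)
        hHi.integral_norm_prod_right ?_
      filter_upwards [hS] with x hx
      rw [hx, add_sub_cancel_right]
      exact norm_integral_le_integral_norm (fun t => H t x)
    have h2 : ∫ x, ∫ t, ‖H t x‖ ∂μ ∂ν ≤ (∫ t, φ t ∂μ) * (K * (b - a)) := by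
      rw [← integral_integral_swap (f := fun t x => ‖H t x‖) hHi.norm, ← integral_mul_const]
      exact integral_mono_ae hHi.integral_norm_prod_left (hi'.mul_const _) hbound
    rw [inv_mul_le_iff₀ hba]
    linarith
  · have hS : sOpRR φ f =ᵐ[ν] fun _ => 0 := by
      filter_upwards [hHx] with x hx
      unfold sOpRR
      refine integral_undef fun hcon => hc ?_
      refine (hcon.sub hx).congr (ae_of_all _ fun t => ?_)
      simp only [hH, Pi.sub_apply]; ring
    have hmean : ∫ y, sOpRR φ f y ∂ν = 0 := by rw [integral_congr_ae hS]; simp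
    refine ⟨(integrable_zero _ _ _).congr hS.symm, ?_⟩
    rw [hmean]
    have : ∫ x, |sOpRR φ f x - (b - a)⁻¹ * 0| ∂ν = 0 := by
      refine integral_eq_zero_of_ae ?_
      filter_upwards [hS] with x hx
      simp [hx]
    rw [this, mul_zero]
    exact mul_nonneg (integral_nonneg hφ) hK0

lemma bmo_upper {φ f : ℝ → ℝ} (hφ : ∀ t, 0 ≤ φ t) (hi : IntegrableOn φ (Set.Ioi 0))
    (hf : MemBMO f) :
    bmoNorm (sOpRR φ f) ≤ ENNReal.ofReal (∫ t in Set.Ioi (0 : ℝ), φ t) * bmoNorm f := by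
  conv_lhs => unfold bmoNorm
  refine iSup_le fun a => iSup_le fun b => iSup_le fun hab => ?_
  rw [← ENNReal.ofReal_toReal hf.2.ne, ← ENNReal.ofReal_mul (integral_nonneg hφ)]
  exact ENNReal.ofReal_le_ofReal (bmo_key hφ hi hf hab).2

lemma bmo_upper_mem {φ f : ℝ → ℝ} (hφ : ∀ t, 0 ≤ φ t) (hi : IntegrableOn φ (Set.Ioi 0))
    (hf : MemBMO f) : MemBMO (sOpRR φ f) := by
  refine ⟨fun x => ⟨Set.Ioo (x - 1) (x + 1), Ioo_mem_nhds (by linarith) (by linarith), 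
    (bmo_key hφ hi hf (by linarith)).1⟩, 
    (bmo_upper hφ hi hf).trans_lt (ENNReal.mul_lt_top ENNReal.ofReal_lt_top hf.2)⟩

lemma bmo_bdd {f : ℝ → ℝ} (hm : Measurable f) (h1 : ∀ x, |f x| ≤ 1) :
    MemBMO f ∧ bmoNorm f ≤ 2 := by
  have hn : bmoNorm f ≤ 2 := by
    unfold bmoNorm
    refine iSup_le fun a => iSup_le fun b => iSup_le fun hab => ?_
    have hba : 0 < b - a := sub_pos.2 hab
    have hνr : (volume.restrict (Set.Ioo a b)).real univ = b - a := by
      simp [Measure.real, ENNReal.toReal_ofReal hba.le]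
    have hbd : ∀ (g : ℝ → ℝ) (C : ℝ), (∀ x, |g x| ≤ C) →
        |∫ x in Set.Ioo a b, g x| ≤ C * (b - a) := by
      intro g C hg
      have := norm_integral_le_of_norm_le_const (μ := volume.restrict (Set.Ioo a b))
        (f := g) (C := C) (ae_of_all _ hg)
      rwa [hνr] at this
    have hmean : |(b - a)⁻¹ * ∫ y in Set.Ioo a b, f y| ≤ 1 := by
      rw [abs_mul, abs_of_pos (inv_pos.2 hba), inv_mul_le_iff₀ hba, mul_one]
      simpa using hbd f 1 h1
    have h2 := hbd (fun x => |f x - (b - a)⁻¹ * ∫ y in Set.Ioo a b, f y|) 2 (fun x => by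
      rw [abs_abs]
      exact (abs_sub _ _).trans (by linarith [h1 x]))
    refine ENNReal.ofReal_le_of_le_toReal ?_
    rw [inv_mul_le_iff₀ hba]
    have := le_abs_self (∫ x in Set.Ioo a b, |f x - (b - a)⁻¹ * ∫ y in Set.Ioo a b, f y|)
    simp only [ENNReal.toReal_ofNat]
    linarith
  refine ⟨⟨?_, hn.trans_lt (by simp)⟩, hn⟩
  exact (locallyIntegrable_const (1:ℝ)).mono hm.aestronglyMeasurable
    (ae_of_all _ fun x => by simpa using h1 x)

lemma bmo_odd {f : ℝ → ℝ} (hodd : ∀ x, f (-x) = - f x) {r : ℝ} (hr : 0 < r) :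
    ENNReal.ofReal ((2 * r)⁻¹ * ∫ x in Set.Ioo (-r) r, |f x|) ≤ bmoNorm f := by
  have hlt : -r < r := by linarith
  have h0 : ∫ x in Set.Ioo (-r) r, f x = 0 := by
    rw [bmo_Ioo_eq _ hlt]
    have h := intervalIntegral.integral_comp_neg (a := -r) (b := r) f
    simp only [hodd, neg_neg, intervalIntegral.integral_neg] at h
    linarith
  unfold bmoNorm
  refine le_iSup_of_le (-r) (le_iSup_of_le r (le_iSup_of_le hlt ?_))
  rw [h0]
  simp only [mul_zero, sub_zero]
  rw [show r - -r = 2 * r by ring]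

lemma bmo_smul (f : ℝ → ℝ) {c : ℝ} (hc : 0 ≤ c) :
    ENNReal.ofReal c * bmoNorm f ≤ bmoNorm (fun x => c * f x) := by
  unfold bmoNorm
  simp only [ENNReal.mul_iSup]
  refine iSup_mono fun a => iSup_mono fun b => iSup_mono fun hab => ?_
  rw [← ENNReal.ofReal_mul hc]
  refine ENNReal.ofReal_le_ofReal (le_of_eq ?_)
  rw [integral_const_mul]
  have : ∀ x, |c * f x - (b - a)⁻¹ * (c * ∫ y in Set.Ioo a b, f y)| =
      c * |f x - (b - a)⁻¹ * ∫ y in Set.Ioo a b, f y| := by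
    intro x
    have e : c * f x - (b - a)⁻¹ * (c * ∫ y in Set.Ioo a b, f y) =
        c * (f x - (b - a)⁻¹ * ∫ y in Set.Ioo a b, f y) := by ring
    rw [e, abs_mul, abs_of_nonneg hc]
  simp only [this]
  rw [integral_const_mul]
  ring

lemma bmo_sign_meas : Measurable Real.sign := by
  unfold Real.sign
  exact Measurable.ite measurableSet_Iio measurable_const
    (Measurable.ite measurableSet_Ioi measurable_const measurable_const)

lemma bmo_sign_abs (x : ℝ) : |Real.sign x| ≤ 1 := by
  rcases Real.sign_apply_eq x with h | h | h <;> simp [h]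

lemma bmo_sign_mul {t : ℝ} (ht : 0 < t) (x : ℝ) : Real.sign (t * x) = Real.sign x := by
  rcases lt_trichotomy x 0 with h | h | h
  · rw [Real.sign_of_neg h, Real.sign_of_neg (mul_neg_of_pos_of_neg ht h)]
  · simp [h]
  · rw [Real.sign_of_pos h, Real.sign_of_pos (mul_pos ht h)]

lemma bmo_sign_pos : bmoNorm Real.sign ≠ 0 := by
  have h := bmo_odd (f := Real.sign) (fun x => Real.sign_neg) one_pos
  refine (lt_of_lt_of_le ?_ h).ne'
  rw [ENNReal.ofReal_pos]
  have : ∫ x in Set.Ioo (-1:ℝ) 1, |Real.sign x| = ∫ x in Set.Ioo (-1:ℝ) 1, (1:ℝ) := by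
    refine integral_congr_ae (ae_restrict_of_ae ?_)
    filter_upwards [compl_mem_ae_iff.2 (measure_singleton (0:ℝ))] with x hx
    rcases Real.sign_apply_eq_of_ne_zero x hx with h | h <;> simp [h]
  rw [this]
  simp

lemma bmo_lower {φ : ℝ → ℝ} (hφ : ∀ t, 0 ≤ φ t) {C : ℝ≥0∞}
    (h : bmoNorm (sOpRR φ Real.sign) ≤ C * bmoNorm Real.sign) :
    ENNReal.ofReal (∫ t in Set.Ioi (0 : ℝ), φ t) ≤ C := by
  have hS : sOpRR φ Real.sign = fun x => (∫ t in Set.Ioi (0 : ℝ), φ t) * Real.sign x := by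
    funext x
    unfold sOpRR
    rw [← integral_mul_const]
    refine setIntegral_congr_fun measurableSet_Ioi fun t ht => ?_
    simp only [bmo_sign_mul ht]
  rw [hS] at h
  have h2 := (bmo_smul Real.sign (integral_nonneg hφ)).trans h
  exact (ENNReal.mul_le_mul_iff_left bmo_sign_pos (bmo_bdd bmo_sign_meas bmo_sign_abs).1.2.ne).1 h2

lemma bmo_conv {φ : ℝ → ℝ} (hφ : ∀ t, 0 ≤ φ t)
    (hloc : LocallyIntegrableOn φ (Set.Ioi 0)) {C : ℝ≥0∞} (hC : C < ⊤)
    (h : ∀ f : ℝ → ℝ, MemBMO f →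
        MemBMO (sOpRR φ f) ∧ bmoNorm (sOpRR φ f) ≤ C * bmoNorm f) {a A : ℝ} (ha : 0 < a) :
    ∫ t in Set.Icc a A, φ t ≤ 8 * C.toReal := by
  have hcomp : ∀ u v : ℝ, 0 < u → IntegrableOn φ (Set.Icc u v) := fun u v hu =>
    hloc.integrableOn_compact_subset (fun t ht => lt_of_lt_of_le hu ht.1) isCompact_Icc
  set s : Set ℝ := {x | a ≤ |x| ∧ |x| ≤ 2 * A} with hs
  have hsm : MeasurableSet s := by
    refine MeasurableSet.inter ?_ ?_
    · exact measurableSet_le measurable_const measurable_norm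
    · exact measurableSet_le measurable_norm measurable_const
  set f : ℝ → ℝ := s.indicator Real.sign with hfdef
  have hfm : Measurable f := bmo_sign_meas.indicator hsm
  have hf1 : ∀ x, |f x| ≤ 1 := by
    intro x
    by_cases hx : x ∈ s
    · rw [hfdef, indicator_of_mem hx]; exact bmo_sign_abs x
    · rw [hfdef, indicator_of_notMem hx]; simp
  have hfo : ∀ x, f (-x) = - f x := by
    intro x
    by_cases hx : x ∈ s
    · have hx' : -x ∈ s := by simpa [hs] using hx
      rw [hfdef, indicator_of_mem hx, indicator_of_mem hx', Real.sign_neg]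
    · have hx' : -x ∉ s := by simpa [hs] using hx
      rw [hfdef, indicator_of_notMem hx, indicator_of_notMem hx']; simp
  obtain ⟨hfB, hf2⟩ := bmo_bdd hfm hf1
  obtain ⟨hSB, hSn⟩ := h f hfB
  have hSo : ∀ x, sOpRR φ f (-x) = - sOpRR φ f x := by
    intro x
    unfold sOpRR
    simp only [mul_neg, hfo, integral_neg]
  have h1 := (bmo_odd hSo two_pos).trans (hSn.trans (mul_le_mul_right hf2 C))
  have h2 : (2 * 2)⁻¹ * ∫ x in Set.Ioo (-2:ℝ) 2, |sOpRR φ f x| ≤ C.toReal * 2 := by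
    have := (ENNReal.ofReal_le_iff_le_toReal (ENNReal.mul_lt_top hC (by simp)).ne).1 h1
    simpa using this
  have hSint : IntegrableOn (fun x => |sOpRR φ f x|) (Set.Ioo (-2:ℝ) 2) :=
    ((hSB.1.integrableOn_isCompact isCompact_Icc).mono_set Ioo_subset_Icc_self).abs
  have hge : ∀ x ∈ Set.Ioo (1:ℝ) 2, ∫ t in Set.Icc a A, φ t ≤ |sOpRR φ f x| := by
    intro x hx
    have hx0 : 0 < x := by linarith [hx.1]
    refine le_trans ?_ (le_abs_self _)
    have hsub : Set.Icc a A ⊆ Set.Ioi 0 := fun t ht => lt_of_lt_of_le ha ht.1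
    have heq : ∀ t ∈ Set.Ioi (0:ℝ), φ t * f (t * x) =
        (Set.Icc (a / x) (2 * A / x)).indicator φ t := by
      intro t ht
      have htx : 0 < t * x := mul_pos ht hx0
      by_cases hts : t * x ∈ s
      · have : t ∈ Set.Icc (a / x) (2 * A / x) := by
          rw [hs, mem_setOf_eq, abs_of_pos htx] at hts
          exact ⟨(div_le_iff₀ hx0).2 hts.1, (le_div_iff₀ hx0).2 hts.2⟩
        rw [hfdef, indicator_of_mem hts, indicator_of_mem this, Real.sign_of_pos htx, mul_one]
      · have : t ∉ Set.Icc (a / x) (2 * A / x) := by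
          intro hh
          apply hts
          rw [hs, mem_setOf_eq, abs_of_pos htx]
          exact ⟨(div_le_iff₀ hx0).1 hh.1, (le_div_iff₀ hx0).1 hh.2⟩
        rw [hfdef, indicator_of_notMem hts, indicator_of_notMem this, mul_zero]
    unfold sOpRR
    rw [setIntegral_congr_fun measurableSet_Ioi heq, setIntegral_indicator measurableSet_Icc]
    have hpos : 0 < a / x := by positivity
    refine setIntegral_mono_set ((hcomp _ _ hpos).mono_set inter_subset_right)
      (ae_of_all _ hφ) (HasSubset.Subset.eventuallyLE ?_)
    intro t ht
    have ht0 : 0 < t := hsub ht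
    refine ⟨ht0, ?_, ?_⟩
    · rw [div_le_iff₀ hx0]; nlinarith [ht.1, hx.1]
    · rw [le_div_iff₀ hx0]; nlinarith [ht.2, hx.2]
  have h3 : ∫ t in Set.Icc a A, φ t ≤ ∫ x in Set.Ioo (-2:ℝ) 2, |sOpRR φ f x| := by
    calc ∫ t in Set.Icc a A, φ t
        = ∫ x in Set.Ioo (1:ℝ) 2, (∫ t in Set.Icc a A, φ t) := by
          rw [setIntegral_const]; simp [Measure.real]; norm_num
      _ ≤ ∫ x in Set.Ioo (1:ℝ) 2, |sOpRR φ f x| := by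
          refine setIntegral_mono_on (integrableOn_const (by simp)) 
            (hSint.mono_set (Ioo_subset_Ioo_left (by norm_num))) measurableSet_Ioo hge
      _ ≤ _ := setIntegral_mono_set hSint (ae_of_all _ fun _ => abs_nonneg _)
          (HasSubset.Subset.eventuallyLE (Ioo_subset_Ioo_left (by norm_num)))
  linarith

lemma bmo_conv' {φ : ℝ → ℝ} (hφ : ∀ t, 0 ≤ φ t)
    (hloc : LocallyIntegrableOn φ (Set.Ioi 0)) {C : ℝ≥0∞} (hC : C < ⊤)
    (h : ∀ f : ℝ → ℝ, MemBMO f →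
        MemBMO (sOpRR φ f) ∧ bmoNorm (sOpRR φ f) ≤ C * bmoNorm f) :
    IntegrableOn φ (Set.Ioi 0) := by
  have hcov : AECover (volume.restrict (Set.Ioi (0:ℝ))) atTop
      (fun n : ℕ => Set.Icc (1 / ((n:ℝ) + 1)) n) := by
    have h1 : AECover (volume.restrict (Set.Ioi (0:ℝ))) atTop
      (fun n : ℕ => Set.Ici (1 / ((n:ℝ) + 1))) := 
      aecover_Ioi_of_Ici tendsto_one_div_add_atTop_nhds_zero_nat
    have h2 : AECover (volume.restrict (Set.Ioi (0:ℝ))) atTop (fun n : ℕ => Set.Iic (n:ℝ)) :=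
      aecover_Iic tendsto_natCast_atTop_atTop
    exact h1.inter h2
  have hpos : ∀ n : ℕ, 0 < 1 / ((n:ℝ) + 1) := fun n => by positivity
  have hr : ∀ n : ℕ, (volume.restrict (Set.Ioi (0:ℝ))).restrict (Set.Icc (1 / ((n:ℝ) + 1)) n) =
      volume.restrict (Set.Icc (1 / ((n:ℝ) + 1)) n) := fun n => by
    refine Measure.restrict_restrict_of_subset fun t ht => lt_of_lt_of_le (hpos n) ht.1
  refine hcov.integrable_of_integral_bounded_of_nonneg_ae (8 * C.toReal) ?_ (ae_of_all _ hφ) ?_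
  · intro n
    unfold IntegrableOn
    rw [hr]
    exact hloc.integrableOn_compact_subset (fun t ht => lt_of_lt_of_le (hpos n) ht.1) isCompact_Icc
  · refine Eventually.of_forall fun n => ?_
    rw [hr]
    exact bmo_conv hφ hloc hC h (hpos n)

/-- Theorem 3.8(i): `S_φ` is bounded on `BMO(ℝ)` iff `∫₀^∞ φ(t) dt < ∞`, and in that
case its operator norm on `BMO(ℝ)` equals `∫₀^∞ φ(t) dt`. -/
theorem sOp_bounded_BMO_iff_and_norm (φ : ℝ → ℝ) (hφ : ∀ t, 0 ≤ φ t)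
    (hloc : LocallyIntegrableOn φ (Set.Ioi 0)) :
    ((∃ C : ℝ≥0∞, C < ⊤ ∧ ∀ f : ℝ → ℝ, MemBMO f →
        MemBMO (sOpRR φ f) ∧ bmoNorm (sOpRR φ f) ≤ C * bmoNorm f) ↔
      IntegrableOn φ (Set.Ioi 0)) ∧
    (IntegrableOn φ (Set.Ioi 0) →
      sInf {C : ℝ≥0∞ | ∀ f : ℝ → ℝ, MemBMO f →
          bmoNorm (sOpRR φ f) ≤ C * bmoNorm f} =
        ENNReal.ofReal (∫ t in Set.Ioi (0 : ℝ), φ t)) := by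
  refine ⟨⟨fun ⟨C, hC, h⟩ => bmo_conv' hφ hloc hC h, fun hi =>
    ⟨_, ENNReal.ofReal_lt_top, fun f hf => ⟨bmo_upper_mem hφ hi hf, bmo_upper hφ hi hf⟩⟩⟩,
    fun hi => le_antisymm (sInf_le fun f hf => bmo_upper hφ hi hf) (le_sInf fun C hC => ?_)⟩
  exact bmo_lower hφ (hC _ (bmo_bdd bmo_sign_meas bmo_sign_abs).1)
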